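/- Let t_0 < t_1 < ⋯ in ℤ^d (lexicographic order) with t_0 > 0, t_n > 3t_{n-1} for all n ≥ 1, and some t_n with all coordinates positive. Let V = {t_n : n ≥ 0} ∪ {-t_n : n ≥ 0}. Then there exists a symmetric subset P of ℤ^d containing 0 such that (V, P) is a co-minimal pair in ℤ^d. -/

import Mathlib

open Pointwise

/-- `ℤ^d` equipped with the lexicographic order. -/
abbrev Zd (d : ℕ) := Lex (Fin d → ℤ)

/-- the value `t (n-1)` with the convention `t_{-1} = 0`. -/
def tprev {d : ℕ} (t : ℕ → Zd d) : ℕ → Zd d := fun n => if n = 0 then 0 else t (n - 1)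

/-- `I_n = X_{-t_n, -t_{n-1}}`. -/
def Iset {d : ℕ} (t : ℕ → Zd d) (n : ℕ) : Set (Zd d) :=
  {x | -(t n) ≤ x} \ {x | -(tprev t n) ≤ x}

/-- `J_n = X_{-t_n, -t_{n-1} - t_{n-2}}`. -/
def Jset {d : ℕ} (t : ℕ → Zd d) (n : ℕ) : Set (Zd d) :=
  {x | -(t n) ≤ x} \ {x | -(tprev t n + tprev t (n - 1)) ≤ x}

/-- `W = {t_n : n ≥ 0} ∪ {0} ∪ {-t_n : n ≥ 0}`. -/
def Wset {d : ℕ} (t : ℕ → Zd d) : Set (Zd d) :=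
  Set.range t ∪ {0} ∪ -(Set.range t)

/-- `V = {t_n : n ≥ 0} ∪ {-t_n : n ≥ 0}`. -/
def Vset {d : ℕ} (t : ℕ → Zd d) : Set (Zd d) :=
  Set.range t ∪ -(Set.range t)

/-- `(A, B)` is a co-minimal pair: `A + B = G` and removing any single element of
`A` or of `B` destroys the complement property. -/
def IsCoMinimalPair {G : Type*} [AddCommGroup G] (A B : Set G) : Prop :=
  A + B = Set.univ ∧
  (∀ a ∈ A, (A \ {a}) + B ≠ Set.univ) ∧
  (∀ b ∈ B, A + (B \ {b}) ≠ Set.univ)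

/-- `P` and `H` are finite and symmetric, every element of `H` is uniquely of the form `v + p`
with `v ∈ V` and `p ∈ P`, and every `p ∈ P` occurs in this way. -/
structure IsPartialComplement {G : Type*} [AddCommGroup G] (V P H : Set G) : Prop where
  finite_left : P.Finite
  finite_right : H.Finite
  neg_left : ∀ p ∈ P, -p ∈ P
  neg_right : ∀ h ∈ H, -h ∈ H
  zero_mem : 0 ∈ P
  exists_sub_mem : ∀ h ∈ H, ∃ p ∈ P, h - p ∈ V
  unique : ∀ h ∈ H, ∀ p ∈ P, ∀ q ∈ P, h - p ∈ V → h - q ∈ V → p = q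
  exists_witness : ∀ p ∈ P, ∃ h ∈ H, h - p ∈ V

namespace IsPartialComplement

variable {G : Type*} [AddCommGroup G] {V P H : Set G}

/-- A pair `p`, `-p` can be added to `P` with witnesses `p + v`, `-(p + v)` when this creates no
further representation of a witness. -/
theorem insert_pair (hP : IsPartialComplement V P H) (hV : ∀ v ∈ V, -v ∈ V) {p v : G}
    (hv : v ∈ V) (hH : ∀ h ∈ H, h - p ∉ V) (hPv : ∀ q ∈ P, p + v - q ∉ V)
    (hpp : p + v + p ∉ V) :
    IsPartialComplement V (P ∪ {p, -p}) (H ∪ {p + v, -(p + v)}) := by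
  have hH' : ∀ h ∈ H, h + p ∉ V := fun h hh hc => hH (-h) (hP.neg_right h hh) (by
    have := hV _ hc
    rwa [show -(h + p) = -h - p by abel] at this)
  have hPv' : ∀ q ∈ P, -(p + v) - q ∉ V := fun q hq hc => hPv (-q) (hP.neg_left q hq) (by
    have := hV _ hc
    rwa [show -(-(p + v) - q) = p + v - -q by abel] at this)
  have hpp' : -(p + v) - p ∉ V := fun hc => hpp (by
    have := hV _ hc
    rwa [show -(-(p + v) - p) = p + v + p by abel] at this)
  have hpv : p + v - p ∈ V := by simpa using hv
  have hnpv : -(p + v) - -p ∈ V := by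
    rw [show -(p + v) - -p = -v by abel]
    exact hV v hv
  refine ⟨hP.finite_left.union (by simp), hP.finite_right.union (by simp), ?_, ?_,
    Or.inl hP.zero_mem, ?_, ?_, ?_⟩
  · rintro q (hq | rfl | rfl)
    · exact Or.inl (hP.neg_left q hq)
    · simp
    · simp
  · rintro q (hq | rfl | rfl)
    · exact Or.inl (hP.neg_right q hq)
    · simp
    · simp
  · rintro h (hh | rfl | rfl)
    · obtain ⟨q, hq, hqV⟩ := hP.exists_sub_mem h hh
      exact ⟨q, Or.inl hq, hqV⟩
    · exact ⟨p, by simp, hpv⟩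
    · exact ⟨-p, by simp, hnpv⟩
  · rintro h (hh | rfl | rfl) q (hq | rfl | rfl) r (hr | rfl | rfl) hqV hrV
    · exact hP.unique h hh q hq r hr hqV hrV
    all_goals simp_all
  · rintro q (hq | rfl | rfl)
    · obtain ⟨h, hh, hhV⟩ := hP.exists_witness q hq
      exact ⟨h, Or.inl hh, hhV⟩
    · exact ⟨q + v, by simp, hpv⟩
    · exact ⟨-(p + v), by simp, hnpv⟩

/-- The union of a chain of partial complements is a co-minimal complement of `V`, provided that
every element of the group gets represented and every `v ∈ V` occurs in a witness. -/
theorem isCoMinimalPair_iUnion {P H : ℕ → Set G}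
    (hPH : ∀ k, IsPartialComplement V (P k) (H k)) (hPm : Monotone P) (hHm : Monotone H)
    (hcover : ∀ g, ∃ k, ∃ p ∈ P k, g - p ∈ V)
    (huse : ∀ v ∈ V, ∃ k, ∃ p ∈ P k, p + v ∈ H k) :
    IsCoMinimalPair V (⋃ k, P k) := by
  have huniq : ∀ i, ∀ h ∈ H i, ∀ j, ∀ p ∈ P j, ∀ k, ∀ q ∈ P k,
      h - p ∈ V → h - q ∈ V → p = q := by
    intro i h hh j p hp k q hq
    refine (hPH (i + j + k)).unique h (hHm ?_ hh) p (hPm ?_ hp) q (hPm ?_ hq) <;> omega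
  refine ⟨Set.eq_univ_of_forall fun g => ?_, fun v hv hc => ?_, fun p hp hc => ?_⟩
  · obtain ⟨k, p, hp, hg⟩ := hcover g
    exact ⟨g - p, hg, p, Set.mem_iUnion.2 ⟨k, hp⟩, by simp⟩
  · obtain ⟨k, p, hp, hh⟩ := huse v hv
    obtain ⟨w, ⟨hw, hwv⟩, q, hq, hwq⟩ : p + v ∈ (V \ {v}) + ⋃ k, P k := hc ▸ Set.mem_univ _
    obtain ⟨j, hq⟩ := Set.mem_iUnion.1 hq
    have hwq : w + q = p + v := hwq
    have hpq : p = q := huniq k _ hh k p hp j q hq (by simpa using hv)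
      (by rw [← hwq]; simpa using hw)
    subst hpq
    exact hwv (by rw [add_comm] at hwq; exact add_left_cancel hwq)
  · obtain ⟨k, hp⟩ := Set.mem_iUnion.1 hp
    obtain ⟨h, hh, hhp⟩ := (hPH k).exists_witness p hp
    obtain ⟨w, hw, q, ⟨hq, hqp⟩, hwq⟩ : h ∈ V + ((⋃ k, P k) \ {p}) := hc ▸ Set.mem_univ _
    obtain ⟨j, hq⟩ := Set.mem_iUnion.1 hq
    have hwq : w + q = h := hwq
    exact hqp (huniq k h hh k p hp j q hq hhp (by rw [← hwq]; simpa using hw)).symm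

end IsPartialComplement

section OrderedGroup

open Filter

theorem neg_mem_range_union_neg_range {G : Type*} [AddCommGroup G] {t : ℕ → G} {v : G}
    (hv : v ∈ Set.range t ∪ -Set.range t) :
    -v ∈ Set.range t ∪ -Set.range t := by
  rcases hv with hv | hv
  · exact Or.inr (by simpa using hv)
  · exact Or.inl hv

theorem three_nsmul_lt_of_lt {G : Type*} [AddCommGroup G] [LinearOrder G] {t : ℕ → G}
    (hmono : StrictMono t) (hgrow : ∀ n, 3 • t n < t (n + 1))
    {m n : ℕ} (hmn : m < n) : 3 • t m < t n :=
  (hgrow m).trans_le (hmono.monotone hmn)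

theorem eventually_lt_of_cofinal {G : Type*} [LinearOrder G] {t : ℕ → G}
    (hmono : StrictMono t) (hcof : ∀ x, ∃ n, x < t n) (x : G) :
    ∀ᶠ n in atTop, x < t n := by
  obtain ⟨N, hN⟩ := hcof x
  exact eventually_atTop.2 ⟨N, fun n hn => hN.trans_le (hmono.monotone hn)⟩

variable {G : Type*} [AddCommGroup G] [LinearOrder G] [IsOrderedAddMonoid G] {t : ℕ → G}

theorem eventually_add_notMem (hmono : StrictMono t) (hpos : 0 < t 0)
    (hgrow : ∀ n, 3 • t n < t (n + 1)) (hcof : ∀ x, ∃ n, x < t n) {c : G} (hc : c ≠ 0) :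
    ∀ᶠ n in atTop, t n + c ∉ Set.range t ∪ -Set.range t := by
  filter_upwards [eventually_lt_of_cofinal hmono hcof (2 • c),
    eventually_lt_of_cofinal hmono hcof (-(2 • c))] with n h1 h2
  have hp : ∀ k, 0 < t k := fun k => hpos.trans_le (hmono.monotone k.zero_le)
  have hn := hp n
  rintro (⟨j, hj⟩ | ⟨j, hj⟩)
  · rcases lt_trichotomy j n with h | rfl | h
    · have := three_nsmul_lt_of_lt hmono hgrow h
      grind
    · exact hc (by simpa using hj)
    · have := three_nsmul_lt_of_lt hmono hgrow h
      grind
  · have := hp j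
    grind

theorem eventually_two_nsmul_add_notMem (hmono : StrictMono t) (hpos : 0 < t 0)
    (hgrow : ∀ n, 3 • t n < t (n + 1)) (hcof : ∀ x, ∃ n, x < t n) (c : G) :
    ∀ᶠ n in atTop, 2 • t n + c ∉ Set.range t ∪ -Set.range t := by
  filter_upwards [eventually_lt_of_cofinal hmono hcof c,
    eventually_lt_of_cofinal hmono hcof (-c)] with n h1 h2
  have hp : ∀ k, 0 < t k := fun k => hpos.trans_le (hmono.monotone k.zero_le)
  have hn := hp n
  rintro (⟨j, hj⟩ | ⟨j, hj⟩)
  · rcases le_or_gt j n with h | h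
    · have := hmono.monotone h
      grind
    · have := three_nsmul_lt_of_lt hmono hgrow h
      grind
  · have := hp j
    grind

theorem IsPartialComplement.exists_cover {P H : Set G} (hmono : StrictMono t) (hpos : 0 < t 0)
    (hgrow : ∀ n, 3 • t n < t (n + 1)) (hcof : ∀ x, ∃ n, x < t n)
    (hP : IsPartialComplement (Set.range t ∪ -Set.range t) P H) (g : G) :
    ∃ P' H', IsPartialComplement (Set.range t ∪ -Set.range t) P' H' ∧ P ⊆ P' ∧ H ⊆ H' ∧
      ∃ p ∈ P', g - p ∈ Set.range t ∪ -Set.range t := by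
  by_cases hg : ∃ p ∈ P, g - p ∈ Set.range t ∪ -Set.range t
  · exact ⟨P, H, hP, subset_rfl, subset_rfl, hg⟩
  push Not at hg
  have h1 : ∀ᶠ n in atTop, ∀ h ∈ H, t n + (h - g) ∉ Set.range t ∪ -Set.range t := by
    rw [eventually_all_finite hP.finite_right]
    intro h hh
    refine eventually_add_notMem hmono hpos hgrow hcof fun hc => ?_
    obtain ⟨p, hp, hpV⟩ := hP.exists_sub_mem h hh
    exact hg p hp (sub_eq_zero.1 hc ▸ hpV)
  obtain ⟨n, hn⟩ := h1.exists
  have hgt : ∀ p ∈ P, g - t n - p ≠ 0 := fun p hp hc =>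
    hg p hp (Or.inl ⟨n, by rw [← sub_eq_zero, ← neg_eq_zero, ← hc]; abel⟩)
  have h2 : ∀ᶠ m in atTop, ∀ p ∈ P,
      t m + (g - t n - p) ∉ Set.range t ∪ -Set.range t := by
    rw [eventually_all_finite hP.finite_left]
    exact fun p hp => eventually_add_notMem hmono hpos hgrow hcof (hgt p hp)
  have h3 : ∀ᶠ m in atTop, t m + 2 • (g - t n) ∉ Set.range t ∪ -Set.range t := by
    refine eventually_add_notMem hmono hpos hgrow hcof fun hc => hgt 0 hP.zero_mem ?_
    grind
  obtain ⟨m, hm2, hm3⟩ := (h2.and h3).exists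
  refine ⟨_, _, hP.insert_pair (p := g - t n) (v := t m)
    (fun _ => neg_mem_range_union_neg_range) (Or.inl ⟨m, rfl⟩) ?_ ?_ ?_,
    Set.subset_union_left, Set.subset_union_left, g - t n, by simp, Or.inl ⟨n, by abel⟩⟩
  · intro h hh
    rw [show h - (g - t n) = t n + (h - g) by abel]
    exact hn h hh
  · intro p hp
    rw [show g - t n + t m - p = t m + (g - t n - p) by abel]
    exact hm2 p hp
  · rwa [show g - t n + t m + (g - t n) = t m + 2 • (g - t n) by abel]

theorem IsPartialComplement.exists_use {P H : Set G} (hmono : StrictMono t) (hpos : 0 < t 0)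
    (hgrow : ∀ n, 3 • t n < t (n + 1)) (hcof : ∀ x, ∃ n, x < t n)
    (hP : IsPartialComplement (Set.range t ∪ -Set.range t) P H) (k : ℕ) :
    ∃ P' H', IsPartialComplement (Set.range t ∪ -Set.range t) P' H' ∧ P ⊆ P' ∧ H ⊆ H' ∧
      ∃ p ∈ P', p + t k ∈ H' := by
  have : Infinite G := Infinite.of_injective t hmono.injective
  obtain ⟨c, hc⟩ := (hP.finite_right.union (hP.finite_left.image (· - t k))).exists_notMem
  have h1 : ∀ᶠ n in atTop, ∀ h ∈ H, t n + (c - h) ∉ Set.range t ∪ -Set.range t := by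
    rw [eventually_all_finite hP.finite_right]
    refine fun h hh => eventually_add_notMem hmono hpos hgrow hcof fun h0 => hc (Or.inl ?_)
    rwa [sub_eq_zero.1 h0]
  have h2 : ∀ᶠ n in atTop, ∀ p ∈ P, t n + (c + t k - p) ∉ Set.range t ∪ -Set.range t := by
    rw [eventually_all_finite hP.finite_left]
    refine fun p hp => eventually_add_notMem hmono hpos hgrow hcof fun h0 =>
      hc (Or.inr ⟨p, hp, ?_⟩)
    change p - t k = c
    rw [← sub_eq_zero.1 h0]
    abel
  have h3 := eventually_two_nsmul_add_notMem hmono hpos hgrow hcof (2 • c + t k)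
  obtain ⟨n, hn1, hn2, hn3⟩ := (h1.and (h2.and h3)).exists
  refine ⟨_, _, hP.insert_pair (p := c + t n) (v := t k)
    (fun _ => neg_mem_range_union_neg_range) (Or.inl ⟨k, rfl⟩) ?_ ?_ ?_,
    Set.subset_union_left, Set.subset_union_left, c + t n, by simp, by simp⟩
  · intro h hh hV
    refine hn1 h hh ?_
    rw [show t n + (c - h) = -(h - (c + t n)) by abel]
    exact neg_mem_range_union_neg_range hV
  · intro p hp
    rw [show c + t n + t k - p = t n + (c + t k - p) by abel]
    exact hn2 p hp
  · rwa [show c + t n + t k + (c + t n) = 2 • t n + (2 • c + t k) by abel]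

theorem exists_isCoMinimalPair_range_union_neg_range [Countable G] (hmono : StrictMono t)
    (hpos : 0 < t 0) (hgrow : ∀ n, 3 • t n < t (n + 1)) (hcof : ∀ x, ∃ n, x < t n) :
    ∃ P : Set G, P = -P ∧ 0 ∈ P ∧ IsCoMinimalPair (Set.range t ∪ -Set.range t) P := by
  obtain ⟨f, hf⟩ := exists_surjective_nat G
  let S := {x : Set G × Set G // IsPartialComplement (Set.range t ∪ -Set.range t) x.1 x.2}
  have hstep : ∀ (k : ℕ) (x : S), ∃ y : S, x.1.1 ⊆ y.1.1 ∧ x.1.2 ⊆ y.1.2 ∧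
      (∃ p ∈ y.1.1, f k - p ∈ Set.range t ∪ -Set.range t) ∧ ∃ p ∈ y.1.1, p + t k ∈ y.1.2 := by
    rintro k ⟨⟨P, H⟩, hP⟩
    obtain ⟨P₁, H₁, hP₁, hPP₁, hHH₁, p, hp, hpV⟩ := hP.exists_cover hmono hpos hgrow hcof (f k)
    obtain ⟨P₂, H₂, hP₂, hPP₂, hHH₂, huse⟩ := hP₁.exists_use hmono hpos hgrow hcof k
    exact ⟨⟨(P₂, H₂), hP₂⟩, hPP₁.trans hPP₂, hHH₁.trans hHH₂, ⟨p, hPP₂ hp, hpV⟩, huse⟩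
  choose next hnextP hnextH hcover huse using hstep
  have h0 : IsPartialComplement (Set.range t ∪ -Set.range t) {0} {t 0, -t 0} := by
    refine ⟨by simp, by simp, by simp, ?_, by simp, ?_, ?_, ?_⟩ <;> simp
  let s : ℕ → S := fun n => Nat.rec ⟨({0}, {t 0, -t 0}), h0⟩ next n
  refine ⟨⋃ k, (s k).1.1, ?_, Set.mem_iUnion.2 ⟨0, (s 0).2.zero_mem⟩,
    IsPartialComplement.isCoMinimalPair_iUnion (H := fun k => (s k).1.2) (fun k => (s k).2)
      (monotone_nat_of_le_succ fun k => hnextP k (s k))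
      (monotone_nat_of_le_succ fun k => hnextH k (s k)) ?_ ?_⟩
  · ext x
    simp only [Set.mem_neg, Set.mem_iUnion]
    refine exists_congr fun k => ⟨(s k).2.neg_left x, fun hx => ?_⟩
    simpa using (s k).2.neg_left _ hx
  · intro g
    obtain ⟨k, rfl⟩ := hf g
    exact ⟨k + 1, hcover k (s k)⟩
  · rintro v (⟨k, rfl⟩ | ⟨k, hk⟩)
    · exact ⟨k + 1, huse k (s k)⟩
    · obtain ⟨p, hp, hpH⟩ := huse k (s k)
      refine ⟨k + 1, -p, (s (k + 1)).2.neg_left p hp, ?_⟩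
      have := (s (k + 1)).2.neg_right _ hpH
      rwa [hk, show -(p + -v) = -p + v by abel] at this

end OrderedGroup

theorem Zd.apply_zero_le {d : ℕ} (hd : 0 < d) {x y : Zd d} (hxy : x ≤ y) :
    ofLex x ⟨0, hd⟩ ≤ ofLex y ⟨0, hd⟩ := by
  rcases hxy.eq_or_lt with rfl | ⟨i, hi, hlt⟩
  · rfl
  · rcases Nat.eq_zero_or_pos i.1 with h | h
    · obtain rfl : i = ⟨0, hd⟩ := Fin.ext h
      exact hlt.le
    · exact (hi ⟨0, hd⟩ h).le

theorem Zd.exists_lt {d : ℕ} (hd : 0 < d) {t : ℕ → Zd d}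
    (hgrow : ∀ n : ℕ, 3 • t n < t (n + 1))
    (hcoord : ∃ n : ℕ, ∀ i : Fin d, 0 < ofLex (t n) i) (x : Zd d) : ∃ n, x < t n := by
  obtain ⟨n, hn⟩ := hcoord
  have key : ∀ k : ℕ, (k : ℤ) < ofLex (t (n + k)) ⟨0, hd⟩ := by
    intro k
    induction k with
    | zero => simpa using hn ⟨0, hd⟩
    | succ k ih =>
      have h : 3 • ofLex (t (n + k)) ⟨0, hd⟩ ≤ ofLex (t (n + (k + 1))) ⟨0, hd⟩ :=
        Zd.apply_zero_le hd (hgrow (n + k)).le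
      rw [nsmul_eq_mul] at h
      push_cast at h ⊢
      linarith
  refine ⟨n + (ofLex x ⟨0, hd⟩).toNat, lt_of_not_ge fun h => ?_⟩
  have h1 := Zd.apply_zero_le hd h
  have h2 := key (ofLex x ⟨0, hd⟩).toNat
  have h3 := Int.self_le_toNat (ofLex x ⟨0, hd⟩)
  omega

theorem stmt10 {d : ℕ} (hd : 0 < d) (t : ℕ → Zd d) (hmono : StrictMono t)
    (hpos : 0 < t 0) (hgrow : ∀ n : ℕ, 3 • t n < t (n + 1))
    (hcoord : ∃ n : ℕ, ∀ i : Fin d, 0 < ofLex (t n) i) :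
    ∃ P : Set (Zd d), P = -P ∧ (0 : Zd d) ∈ P ∧ IsCoMinimalPair (Vset t) P := by
  have : Countable (Zd d) := inferInstanceAs (Countable (Fin d → ℤ))
  exact exists_isCoMinimalPair_range_union_neg_range hmono hpos hgrow
    (Zd.exists_lt hd hgrow hcoord)
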